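/- Let H be a Hopf algebra over a field k and let A be a symmetric left partial H-module algebra. Then the bilinear product on A ⊗ H defined by (a ⊗ h)(b ⊗ k) = a(h₍₁₎·b) ⊗ h₍₂₎k is associative, and 1_A ⊗ 1_H is a left unit for this product. -/

import Mathlib

open TensorProduct

/-- `sw2 k f g` is the Sweedler-style map `h ↦ ∑ f(h₍₁₎) * g(h₍₂₎)`. -/
noncomputable def sw2 (k : Type*) [Field k] {H A : Type*}
    [AddCommGroup H] [Module k H] [Coalgebra k H]
    [Ring A] [Algebra k A] (f g : H →ₗ[k] A) : H →ₗ[k] A :=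
  TensorProduct.lift ((LinearMap.mul k A).compl₁₂ f g) ∘ₗ Coalgebra.comul
/-- A symmetric left partial action of a Hopf algebra `H` on a unital algebra `A`:
(PLA1) `1·a = a`; (PLA2) `h·(ab) = ∑ (h₍₁₎·a)(h₍₂₎·b)`;
(PLA3) `h·(g·a) = ∑ (h₍₁₎·1)(h₍₂₎g·a)`; (PLA3') `h·(g·a) = ∑ (h₍₁₎g·a)(h₍₂₎·1)`. -/
structure IsSymmPartialAction (k : Type*) [Field k] {H A : Type*} [Ring H] [HopfAlgebra k H]
    [Ring A] [Algebra k A] (act : H →ₗ[k] A →ₗ[k] A) : Prop where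
  pla1 : ∀ a : A, act 1 a = a
  pla2 : ∀ (h : H) (a b : A), act h (a * b) = sw2 k (act.flip a) (act.flip b) h
  pla3 : ∀ (h g : H) (a : A),
    act h (act g a) = sw2 k (act.flip 1) (act.flip a ∘ₗ LinearMap.mulRight k g) h
  pla3' : ∀ (h g : H) (a : A),
    act h (act g a) = sw2 k (act.flip a ∘ₗ LinearMap.mulRight k g) (act.flip 1) h

lemma sw2_eq_mul' {k H A : Type*} [Field k] [AddCommGroup H] [Module k H] [Coalgebra k H]
    [Ring A] [Algebra k A] (f g : H →ₗ[k] A) :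
    sw2 k f g = LinearMap.mul' k A ∘ₗ TensorProduct.map f g ∘ₗ Coalgebra.comul := by
  rw [sw2, ← LinearMap.comp_assoc]
  congr 1
  ext x y
  simp

lemma sw2_assoc {k H A : Type*} [Field k] [AddCommGroup H] [Module k H] [Coalgebra k H]
    [Ring A] [Algebra k A] (f g p : H →ₗ[k] A) :
    sw2 k (sw2 k f g) p = sw2 k f (sw2 k g p) := by
  have key : LinearMap.mul' k A ∘ₗ TensorProduct.map (LinearMap.mul' k A ∘ₗ TensorProduct.map f g) p
      = LinearMap.mul' k A ∘ₗ TensorProduct.map f (LinearMap.mul' k A ∘ₗ TensorProduct.map g p) ∘ₗ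
        (TensorProduct.assoc k H H H).toLinearMap := by
    ext x y z
    simp [mul_assoc]
  ext h
  have hl : sw2 k (sw2 k f g) p h =
      (LinearMap.mul' k A ∘ₗ TensorProduct.map (LinearMap.mul' k A ∘ₗ TensorProduct.map f g) p)
        (Coalgebra.comul.rTensor H (Coalgebra.comul h)) := by
    rw [sw2_eq_mul', sw2_eq_mul']
    simp only [LinearMap.comp_apply, LinearMap.rTensor, TensorProduct.map_map, LinearMap.comp_id,
      LinearMap.comp_assoc]
  have hr : sw2 k f (sw2 k g p) h =
      (LinearMap.mul' k A ∘ₗ TensorProduct.map f (LinearMap.mul' k A ∘ₗ TensorProduct.map g p))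
        (Coalgebra.comul.lTensor H (Coalgebra.comul h)) := by
    rw [sw2_eq_mul', sw2_eq_mul']
    simp only [LinearMap.comp_apply, LinearMap.lTensor, TensorProduct.map_map, LinearMap.comp_id,
      LinearMap.comp_assoc]
  rw [hl, hr, key, ← Coalgebra.coassoc_apply]
  rfl

/-- Coassociativity in the form
`∑ f(h₍₁₎₍₁₎) * p(h₍₁₎₍₂₎) ⊗ q(h₍₂₎) = ∑ f(h₍₁₎) * p(h₍₂₎₍₁₎) ⊗ q(h₍₂₎₍₂₎)`. -/
lemma map_sw2_comul {k H A M : Type*} [Field k] [AddCommGroup H] [Module k H] [Coalgebra k H]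
    [Ring A] [Algebra k A] [AddCommGroup M] [Module k M] (f p : H →ₗ[k] A) (q : H →ₗ[k] M)
    {h : H} {ι : Type*} (r : Coalgebra.Repr k h ι) :
    TensorProduct.map (sw2 k f p) q (Coalgebra.comul h) =
      ∑ i ∈ r.index, TensorProduct.map (LinearMap.mulLeft k (f (r.left i)) ∘ₗ p) q
        (Coalgebra.comul (r.right i)) := by
  have key (x : H) (t : H ⊗[k] H) :
      TensorProduct.map (LinearMap.mul' k A ∘ₗ TensorProduct.map f p) q
        ((TensorProduct.assoc k H H H).symm (x ⊗ₜ t)) =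
      TensorProduct.map (LinearMap.mulLeft k (f x) ∘ₗ p) q t := by
    induction t with
    | zero => simp
    | tmul y z => simp
    | add t u ht hu => simp only [TensorProduct.tmul_add, map_add, ht, hu]
  have hl : TensorProduct.map (sw2 k f p) q (Coalgebra.comul h) =
      TensorProduct.map (LinearMap.mul' k A ∘ₗ TensorProduct.map f p) q
        (Coalgebra.comul.rTensor H (Coalgebra.comul h)) := by
    rw [sw2_eq_mul']
    simp only [LinearMap.rTensor, TensorProduct.map_map, LinearMap.comp_id, LinearMap.comp_assoc]
  rw [hl, ← Coalgebra.coassoc_symm_apply, ← r.eq]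
  simp only [map_sum, LinearMap.lTensor_tmul, key]

/-- `h·(b (g·c)) = ∑ (h₍₁₎·b) (h₍₂₎g·c)`. -/
lemma IsSymmPartialAction.flip_mul_act {k H A : Type*} [Field k] [Ring H] [HopfAlgebra k H]
    [Ring A] [Algebra k A] {act : H →ₗ[k] A →ₗ[k] A} (hact : IsSymmPartialAction k act)
    (b c : A) (g : H) :
    act.flip (b * act g c) = sw2 k (act.flip b) (act.flip c ∘ₗ LinearMap.mulRight k g) := by
  have flip_mul (a a' : A) : act.flip (a * a') = sw2 k (act.flip a) (act.flip a') :=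
    LinearMap.ext fun h => hact.pla2 h a a'
  have flip_act : act.flip (act g c) =
      sw2 k (act.flip 1) (act.flip c ∘ₗ LinearMap.mulRight k g) :=
    LinearMap.ext fun h => hact.pla3 h g c
  rw [flip_mul, flip_act, ← sw2_assoc, ← flip_mul, mul_one]

/-- For a symmetric left partial action of a Hopf algebra `H` on `A`, the product on `A ⊗ H`
given by `(a ⊗ h)(b ⊗ g) = ∑ a(h₍₁₎·b) ⊗ h₍₂₎g` is associative, and `1_A ⊗ 1_H` is a left
unit for it. -/
theorem smashProduct_mul_assoc_and_one_mul
    {k H A : Type*} [Field k] [Ring H] [HopfAlgebra k H] [Ring A] [Algebra k A]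
    (act : H →ₗ[k] A →ₗ[k] A) (hact : IsSymmPartialAction k act)
    (m : (A ⊗[k] H) →ₗ[k] (A ⊗[k] H) →ₗ[k] (A ⊗[k] H))
    (hm : ∀ (a b : A) (h g : H), m (a ⊗ₜ[k] h) (b ⊗ₜ[k] g) =
      (TensorProduct.map ((LinearMap.mulLeft k a) ∘ₗ act.flip b) (LinearMap.mulRight k g))
        (Coalgebra.comul h)) :
    (∀ x y z : A ⊗[k] H, m (m x y) z = m x (m y z)) ∧
    (∀ x : A ⊗[k] H, m ((1 : A) ⊗ₜ[k] (1 : H)) x = x) := by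
  have tmul_assoc (a b c : A) (h g l : H) :
      m (m (a ⊗ₜ[k] h) (b ⊗ₜ[k] g)) (c ⊗ₜ[k] l) = m (a ⊗ₜ[k] h) (m (b ⊗ₜ[k] g) (c ⊗ₜ[k] l)) := by
    let r := Coalgebra.Repr.arbitrary k h
    let s := Coalgebra.Repr.arbitrary k g
    have comul_mul (u : H ⊗[k] H) (a' : A) (x y : H) :
        TensorProduct.map (LinearMap.mulLeft k a' ∘ₗ act.flip c) (LinearMap.mulRight k l)
          (u * x ⊗ₜ[k] y) =
        (LinearMap.mulLeft k a').rTensor H (TensorProduct.map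
          (act.flip c ∘ₗ LinearMap.mulRight k x) (LinearMap.mulRight k (y * l)) u) := by
      induction u with
      | zero => simp
      | tmul v w => simp [mul_assoc]
      | add u v hu hv => simp only [add_mul, map_add, hu, hv]
    have left_mul (a' : A) (p : H →ₗ[k] A) (n : H →ₗ[k] H) (u : H ⊗[k] H) (b' : A) :
        (LinearMap.mulLeft k (a' * b')).rTensor H (TensorProduct.map p n u) =
        (LinearMap.mulLeft k a').rTensor H
          (TensorProduct.map (LinearMap.mulLeft k b' ∘ₗ p) n u) := by
      simp only [LinearMap.rTensor, TensorProduct.map_map, LinearMap.mulLeft_mul,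
        LinearMap.comp_assoc]
    have hl : m (m (a ⊗ₜ[k] h) (b ⊗ₜ[k] g)) (c ⊗ₜ[k] l) =
        ∑ i ∈ r.index, ∑ j ∈ s.index, (LinearMap.mulLeft k a).rTensor H
          (TensorProduct.map (LinearMap.mulLeft k (act.flip b (r.left i)) ∘ₗ
            (act.flip c ∘ₗ LinearMap.mulRight k (s.left j)))
            (LinearMap.mulRight k (s.right j * l)) (Coalgebra.comul (r.right i))) := by
      rw [hm, ← r.eq]
      simp only [map_sum, LinearMap.sum_apply, TensorProduct.map_tmul, LinearMap.comp_apply,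
        LinearMap.mulLeft_apply, LinearMap.mulRight_apply, hm, Bialgebra.comul_mul]
      refine Finset.sum_congr rfl fun i _ => ?_
      rw [← s.eq, Finset.mul_sum, map_sum]
      refine Finset.sum_congr rfl fun j _ => ?_
      rw [comul_mul, left_mul a]
    have hr : m (a ⊗ₜ[k] h) (m (b ⊗ₜ[k] g) (c ⊗ₜ[k] l)) =
        ∑ j ∈ s.index, (LinearMap.mulLeft k a).rTensor H
          (TensorProduct.map (sw2 k (act.flip b) (act.flip c ∘ₗ LinearMap.mulRight k (s.left j)))
            (LinearMap.mulRight k (s.right j * l)) (Coalgebra.comul h)) := by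
      rw [hm b, ← s.eq]
      simp only [map_sum, TensorProduct.map_tmul, LinearMap.comp_apply,
        LinearMap.mulLeft_apply, LinearMap.mulRight_apply, hm, LinearMap.flip_apply,
        hact.flip_mul_act, LinearMap.rTensor, TensorProduct.map_map, LinearMap.id_comp]
    rw [hl, hr, Finset.sum_comm]
    refine Finset.sum_congr rfl fun j _ => ?_
    rw [map_sw2_comul _ _ _ r, map_sum]
  refine ⟨fun x y z => ?_, fun x => ?_⟩
  · induction x with
    | zero => simp
    | add x x' hx hx' => simp only [map_add, LinearMap.add_apply, hx, hx']
    | tmul a h =>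
      induction y with
      | zero => simp
      | add y y' hy hy' => simp only [map_add, LinearMap.add_apply, hy, hy']
      | tmul b g =>
        induction z with
        | zero => simp
        | add z z' hz hz' => simp only [map_add, hz, hz']
        | tmul c l => exact tmul_assoc a b c h g l
  · induction x with
    | zero => simp
    | add x x' hx hx' => simp only [map_add, hx, hx']
    | tmul a h => simp [hm, Bialgebra.comul_one, Algebra.TensorProduct.one_def, hact.pla1]
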